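/- For k, n ∈ ℕ with 0 ≤ k ≤ n-1, the number of k-Naples parking functions of length n+1 satisfies |PF_{n+1}(k)| = Σ_{i=0}^{n} C(n,i) · min(i+1+k, n+1) · |PF_i(k)| · (n-i+1)^(n-i-1). -/

import Mathlib

/-- Try to park a car with preference `a` under the `(k,l)`-pullback rule on a
street with spots `1,…,n`, where `occ` is the set of occupied spots.  The car
parks at `a` if it is free; otherwise it checks `a-1,…,a-k` (not before spot 1)
and parks in the first free spot found; failing that it checks `a+1,…,a+l`
(not beyond spot `n`).  Returns the spot where the car parks, if any. -/
def pullTry (k l n : ℕ) (occ : Finset ℕ) (a : ℕ) : Option ℕ :=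
  if a ∉ occ then some a
  else
    match ((List.range k).map (fun j => a - (j + 1))).find?
        (fun s => decide (1 ≤ s ∧ s ∉ occ)) with
    | some s => some s
    | none =>
        ((List.range l).map (fun j => a + (j + 1))).find?
          (fun s => decide (s ≤ n ∧ s ∉ occ))

/-- Park a list of cars sequentially by the `(k,l)`-pullback rule, returning the
list of spots where they park (in order) if all of them park. -/
def pullRunAux (k l n : ℕ) : List ℕ → Finset ℕ → Option (List ℕ)
  | [], _ => some []
  | a :: rest, occ =>
    match pullTry k l n occ a with
    | none => none
    | some s => (pullRunAux k l n rest (insert s occ)).map (fun t => s :: t)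

def pullRun (k l n : ℕ) (prefs : List ℕ) : Option (List ℕ) :=
  pullRunAux k l n prefs ∅

/-- The `k`-Naples rule: back up at most `k` spots, then drive forward all the
way to spot `n`. -/
def naplesTry (k n : ℕ) (occ : Finset ℕ) (a : ℕ) : Option ℕ :=
  if a ∉ occ then some a
  else
    match ((List.range k).map (fun j => a - (j + 1))).find?
        (fun s => decide (1 ≤ s ∧ s ∉ occ)) with
    | some s => some s
    | none => (List.range' (a + 1) (n - a)).find? (fun s => decide (s ∉ occ))

def naplesRunAux (k n : ℕ) : List ℕ → Finset ℕ → Option (List ℕ)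
  | [], _ => some []
  | a :: rest, occ =>
    match naplesTry k n occ a with
    | none => none
    | some s => (naplesRunAux k n rest (insert s occ)).map (fun t => s :: t)

def naplesRun (k n : ℕ) (prefs : List ℕ) : Option (List ℕ) :=
  naplesRunAux k n prefs ∅

/-- The classical rule: park in the first free spot among `a, a+1, …, n`. -/
def classicalTry (n : ℕ) (occ : Finset ℕ) (a : ℕ) : Option ℕ :=
  (List.range' a (n + 1 - a)).find? (fun s => decide (s ∉ occ))

def classicalRunAux (n : ℕ) : List ℕ → Finset ℕ → Option (List ℕ)
  | [], _ => some []
  | a :: rest, occ =>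
    match classicalTry n occ a with
    | none => none
    | some s => (classicalRunAux n rest (insert s occ)).map (fun t => s :: t)

def classicalRun (n : ℕ) (prefs : List ℕ) : Option (List ℕ) :=
  classicalRunAux n prefs ∅

/-- The list of (1-based) preferences encoded by a tuple `α ∈ [n]^m`. -/
def prefList {m n : ℕ} (α : Fin m → Fin n) : List ℕ :=
  List.ofFn (fun i => (α i : ℕ) + 1)

/-- The finset of `(k,l)`-pullback `(m,n)`-parking functions. -/
def pullPFs (k l m n : ℕ) : Finset (Fin m → Fin n) :=
  Finset.univ.filter (fun α => (pullRun k l n (prefList α)).isSome = true)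

/-- The finset of `k`-Naples `(m,n)`-parking functions. -/
def naplesPFs (k m n : ℕ) : Finset (Fin m → Fin n) :=
  Finset.univ.filter (fun α => (naplesRun k n (prefList α)).isSome = true)

/-- The finset of classical `(m,n)`-parking functions. -/
def classicalPFs (m n : ℕ) : Finset (Fin m → Fin n) :=
  Finset.univ.filter (fun α => (classicalRun n (prefList α)).isSome = true)

theorem naplesTry_eq_some_iff {k n : ℕ} {occ : Finset ℕ} {a s : ℕ} (ha : 1 ≤ a) (han : a ≤ n) :
    naplesTry k n occ a = some s ↔ s ∉ occ ∧
      ((1 ≤ s ∧ s ≤ a ∧ a ≤ s + k ∧ ∀ x, s < x → x ≤ a → x ∈ occ) ∨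
        (a < s ∧ s ≤ n ∧ ∀ x, 1 ≤ x → a ≤ x + k → x < s → x ∈ occ)) := by
  unfold naplesTry
  split_ifs with hocc
  · split
    · next r hr =>
      simp only [List.find?_map, Option.map_eq_some_iff, List.find?_range_eq_some,
        Function.comp_apply, decide_eq_true_eq, List.mem_range, Bool.not_eq_true',
        decide_eq_false_iff_not, not_and, not_not] at hr
      obtain ⟨j, ⟨⟨hj₁, hj₂⟩, hj₃, hj₄⟩, rfl⟩ := hr
      have hback : ∀ x, a - (j + 1) < x → x ≤ a → x ∈ occ := by
        intro x hx hxa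
        obtain rfl | hne := eq_or_ne x a
        · exact hocc
        · have := hj₄ (a - x - 1) (by lia)
          rw [show a - (a - x - 1 + 1) = x by lia] at this
          exact this (by lia)
      rw [Option.some.injEq]
      constructor
      · rintro rfl
        exact ⟨hj₂, Or.inl ⟨hj₁, by lia, by lia, hback⟩⟩
      · rintro ⟨hs, ⟨h₁, h₂, h₃, h₄⟩ | ⟨h₁, h₂, h₃⟩⟩
        · by_contra hne
          obtain hlt | hlt := lt_or_gt_of_ne hne
          · exact hs (hback s hlt h₂)
          · exact hj₂ (h₄ _ hlt (by lia))
        · exact absurd (h₃ _ hj₁ (by lia) (by lia)) hj₂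
    · next hr =>
      simp only [List.find?_eq_none, List.mem_map, List.mem_range, decide_eq_true_eq, not_and,
        not_not, forall_exists_index, and_imp] at hr
      have hback : ∀ x, 1 ≤ x → a ≤ x + k → x ≤ a → x ∈ occ := by
        intro x hx hxk hxa
        obtain rfl | hne := eq_or_ne x a
        · exact hocc
        · exact hr x (a - x - 1) (by lia) (by lia) hx
      simp only [List.find?_range'_eq_some, decide_eq_true_eq, List.mem_range'_1,
        Bool.not_eq_true', decide_eq_false_iff_not, not_not]
      constructor
      · rintro ⟨hs, ⟨h₁, h₂⟩, h₃⟩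
        refine ⟨hs, Or.inr ⟨by lia, by lia, fun x hx hxk hxs => ?_⟩⟩
        obtain hxa | hxa := le_or_gt x a
        · exact hback x hx hxk hxa
        · exact h₃ x (by lia) hxs
      · rintro ⟨hs, ⟨h₁, h₂, h₃, h₄⟩ | ⟨h₁, h₂, h₃⟩⟩
        · exact absurd (hback s h₁ h₃ h₂) hs
        · exact ⟨hs, by lia, fun x hx hxs => h₃ x (by lia) (by lia) hxs⟩
  · simp only [Option.some.injEq]
    constructor
    · rintro rfl
      exact ⟨hocc, Or.inl ⟨ha, le_rfl, by lia, fun x h₁ h₂ => by lia⟩⟩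
    · rintro ⟨hs, ⟨h₁, h₂, h₃, h₄⟩ | ⟨h₁, h₂, h₃⟩⟩
      · by_contra hne
        exact hocc (h₄ a (by lia) le_rfl)
      · exact absurd (h₃ a ha (by lia) h₁) hocc

/-- The number of ways to fill the set `S` of spots one car at a time with `t` cars, where `c T s`
is the number of preferences that send a car to the spot `s` when the spots in `T` are occupied. -/
def parkingWays {α : Type*} [DecidableEq α] (c : Finset α → α → ℕ) : ℕ → Finset α → ℕ
  | 0, S => if S = ∅ then 1 else 0
  | t + 1, S => ∑ s ∈ S, c (S.erase s) s * parkingWays c t (S.erase s)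

theorem sum_powersetCard_succ_erase {α : Type*} [DecidableEq α] (U : Finset α) (t : ℕ)
    (g : Finset α → α → ℕ) :
    ∑ S ∈ U.powersetCard (t + 1), ∑ s ∈ S, g (S.erase s) s
      = ∑ T ∈ U.powersetCard t, ∑ s ∈ U \ T, g T s := by
  rw [Finset.sum_sigma', Finset.sum_sigma']
  refine Finset.sum_bij' (fun p _ => ⟨p.1.erase p.2, p.2⟩) (fun p _ => ⟨insert p.2 p.1, p.2⟩)
    ?_ ?_ ?_ ?_ ?_
  · rintro ⟨S, s⟩ h
    simp only [Finset.mem_sigma, Finset.mem_powersetCard, Finset.mem_sdiff] at h ⊢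
    obtain ⟨⟨h₁, h₂⟩, h₃⟩ := h
    refine ⟨⟨(Finset.erase_subset _ _).trans h₁, ?_⟩, h₁ h₃, Finset.notMem_erase _ _⟩
    rw [Finset.card_erase_of_mem h₃, h₂, Nat.add_sub_cancel]
  · rintro ⟨T, s⟩ h
    simp only [Finset.mem_sigma, Finset.mem_powersetCard, Finset.mem_sdiff] at h ⊢
    obtain ⟨⟨h₁, h₂⟩, h₃, h₄⟩ := h
    refine ⟨⟨Finset.insert_subset h₃ h₁, ?_⟩, Finset.mem_insert_self _ _⟩
    rw [Finset.card_insert_of_notMem h₄, h₂]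
  · rintro ⟨S, s⟩ h
    simp only [Finset.mem_sigma] at h
    simp [Finset.insert_erase h.2]
  · rintro ⟨T, s⟩ h
    simp only [Finset.mem_sigma, Finset.mem_sdiff] at h
    simp [Finset.erase_insert h.2.2]
  · intro _ _
    rfl

theorem sum_parkingWays_mul {α : Type*} [DecidableEq α] {U : Finset α} {c : Finset α → α → ℕ}
    {G : ℕ → Finset α → ℕ} {b : ℕ}
    (hG : ∀ t T, T ⊆ U → T.card + (t + 1) = b →
      G (t + 1) T = ∑ s ∈ U \ T, c T s * G t (insert s T)) (j t : ℕ) (hjt : j + t = b) :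
    ∑ S ∈ U.powersetCard j, parkingWays c j S * G t S = G b ∅ := by
  induction j generalizing t with
  | zero => simp_all [parkingWays]
  | succ j ih =>
    rw [← ih (t + 1) (by lia)]
    calc
      _ = ∑ S ∈ U.powersetCard (j + 1), ∑ s ∈ S,
          c (S.erase s) s * parkingWays c j (S.erase s) * G t (insert s (S.erase s)) := by
        refine Finset.sum_congr rfl fun S _ => ?_
        rw [parkingWays, Finset.sum_mul]
        exact Finset.sum_congr rfl fun s hs => by rw [Finset.insert_erase hs]
      _ = _ := by
        rw [sum_powersetCard_succ_erase U j
          (fun T s => c T s * parkingWays c j T * G t (insert s T))]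
        refine Finset.sum_congr rfl fun T hT => ?_
        rw [Finset.mem_powersetCard] at hT
        rw [hG t T hT.1 (by lia), Finset.mul_sum]
        exact Finset.sum_congr rfl fun s _ => by ring

theorem parkingWays_image {α β : Type*} [DecidableEq α] [DecidableEq β] {f : α → β}
    {c : Finset α → α → ℕ} {c' : Finset β → β → ℕ} (t : ℕ) {S : Finset α}
    (hf : Set.InjOn f S)
    (hc : ∀ T ⊆ S, ∀ s ∈ S, s ∉ T → c' (T.image f) (f s) = c T s) :
    parkingWays c' t (S.image f) = parkingWays c t S := by
  induction t generalizing S with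
  | zero => simp [parkingWays]
  | succ t ih =>
    rw [parkingWays, parkingWays, Finset.sum_image hf]
    refine Finset.sum_congr rfl fun s hs => ?_
    have hsub := Finset.erase_subset s S
    have he : (S.image f).erase (f s) = (S.erase s).image f := by
      ext y
      simp only [Finset.mem_erase, Finset.mem_image]
      constructor
      · rintro ⟨hy, x, hx, rfl⟩
        exact ⟨x, ⟨fun h => hy (h ▸ rfl), hx⟩, rfl⟩
      · rintro ⟨x, ⟨hne, hx⟩, rfl⟩
        exact ⟨fun h => hne (hf hx hs h), x, hx, rfl⟩
    rw [he, hc _ hsub s hs (Finset.notMem_erase _ _),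
      ih (hf.mono (by exact_mod_cast hsub))
        fun T hT x hx => hc T (hT.trans hsub) x (hsub hx)]

theorem parkingWays_union {α : Type*} [DecidableEq α] {c cA cB : Finset α → α → ℕ}
    (a b : ℕ) {A B : Finset α} (ha : A.card = a) (hb : B.card = b) (hAB : Disjoint A B)
    (hA : ∀ A' ⊆ A, ∀ B' ⊆ B, ∀ s ∈ A, s ∉ A' → c (A' ∪ B') s = cA A' s)
    (hB : ∀ A' ⊆ A, ∀ B' ⊆ B, ∀ s ∈ B, s ∉ B' → c (A' ∪ B') s = cB B' s) :
    parkingWays c (a + b) (A ∪ B)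
      = (a + b).choose a * parkingWays cA a A * parkingWays cB b B := by
  induction h : a + b generalizing a b A B with
  | zero =>
    obtain ⟨rfl, rfl⟩ : a = 0 ∧ b = 0 := by lia
    simp_all [parkingWays]
  | succ t ih =>
    have hsumA : ∑ s ∈ A, c ((A ∪ B).erase s) s * parkingWays c t ((A ∪ B).erase s)
        = if a = 0 then 0 else t.choose (a - 1) * parkingWays cA a A * parkingWays cB b B := by
      obtain _ | a := a
      · simp_all
      · rw [if_neg (by lia), parkingWays, Finset.mul_sum, Finset.sum_mul]
        refine Finset.sum_congr rfl fun s hs => ?_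
        have hsB : s ∉ B := Finset.disjoint_left.mp hAB hs
        have hsub := Finset.erase_subset s A
        rw [Finset.erase_union_distrib, Finset.erase_eq_of_notMem hsB,
          hA _ hsub B subset_rfl s hs (Finset.notMem_erase _ _),
          ih a b (by rw [Finset.card_erase_of_mem hs]; lia) hb
            (hAB.mono_left hsub)
            (fun A' hA' B' hB' x hx => hA A' (hA'.trans hsub) B' hB' x (hsub hx))
            (fun A' hA' => hB A' (hA'.trans hsub)) (by lia)]
        simp only [Nat.add_sub_cancel]
        ring
    have hsumB : ∑ s ∈ B, c ((A ∪ B).erase s) s * parkingWays c t ((A ∪ B).erase s)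
        = if b = 0 then 0 else t.choose a * parkingWays cA a A * parkingWays cB b B := by
      obtain _ | b := b
      · simp_all
      · rw [if_neg (by lia), parkingWays, Finset.mul_sum]
        refine Finset.sum_congr rfl fun s hs => ?_
        have hsA : s ∉ A := Finset.disjoint_right.mp hAB hs
        have hsub := Finset.erase_subset s B
        rw [Finset.erase_union_distrib, Finset.erase_eq_of_notMem hsA,
          hB A subset_rfl _ hsub s hs (Finset.notMem_erase _ _),
          ih a b ha (by rw [Finset.card_erase_of_mem hs]; lia)
            (hAB.mono_right hsub)
            (fun A' hA' B' hB' => hA A' hA' B' (hB'.trans hsub))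
            (fun A' hA' B' hB' x hx => hB A' hA' B' (hB'.trans hsub) x (hsub hx)) (by lia)]
        ring
    rw [parkingWays, Finset.sum_union hAB, hsumA, hsumB]
    obtain _ | a := a
    · rw [if_pos rfl, if_neg (by lia)]
      simp
    · obtain _ | b := b
      · obtain rfl : a = t := by lia
        simp
      · rw [if_neg (by lia), if_neg (by lia), Nat.choose_succ_succ, Nat.add_sub_cancel]
        ring

/-- The number of preferences in `[n]` that send a car to the spot `s` under the `k`-Naples rule. -/
def naplesWeight (k n : ℕ) (occ : Finset ℕ) (s : ℕ) : ℕ :=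
  ((Finset.Icc 1 n).filter fun a => naplesTry k n occ a = some s).card

theorem card_naplesPFs_eq (k n : ℕ) :
    (naplesPFs k n n).card = parkingWays (naplesWeight k n) n (Finset.Icc 1 n) := by
  let G : ℕ → Finset ℕ → ℕ := fun t occ =>
    (Finset.univ.filter fun α : Fin t → Fin n =>
      (naplesRunAux k n (prefList α) occ).isSome = true).card
  have hG : ∀ t T, T ⊆ Finset.Icc 1 n → T.card + (t + 1) = n →
      G (t + 1) T = ∑ s ∈ Finset.Icc 1 n \ T, naplesWeight k n T s * G t (insert s T) := by
    intro t T _ _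
    have hcons : G (t + 1) T = ∑ a ∈ Finset.Icc 1 n,
        (naplesTry k n T a).elim 0 fun s => G t (insert s T) := by
      simp only [G, Finset.card_filter]
      rw [← (Fin.consEquiv fun _ => Fin n).sum_comp, Fintype.sum_prod_type]
      refine Finset.sum_nbij (fun a : Fin n => (a : ℕ) + 1) ?_ ?_ ?_ ?_
      · intro a _
        simp
      · intro a _ b _ hab
        simpa [Fin.ext_iff] using hab
      · intro a ha
        simp only [Finset.coe_Icc, Set.mem_Icc] at ha
        exact ⟨⟨a - 1, by lia⟩, by simp, by simp; lia⟩
      · intro a _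
        simp only [prefList, Fin.consEquiv_apply, List.ofFn_succ, Fin.cons_zero, Fin.cons_succ,
          naplesRunAux]
        rcases naplesTry k n T (a + 1) with _ | s
        · simp
        · exact Finset.sum_congr rfl fun β _ => if_congr (by simp) rfl rfl
    rw [hcons]
    simp only [naplesWeight, Finset.card_filter, Finset.sum_mul]
    rw [Finset.sum_comm]
    refine Finset.sum_congr rfl fun a ha => ?_
    rw [Finset.mem_Icc] at ha
    rcases hs : naplesTry k n T a with _ | s
    · simp
    · have hmem : s ∈ Finset.Icc 1 n \ T := by
        rw [naplesTry_eq_some_iff ha.1 ha.2] at hs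
        rw [Finset.mem_sdiff, Finset.mem_Icc]
        exact ⟨by lia, hs.1⟩
      simp [hmem]
  have := sum_parkingWays_mul hG n 0 (by lia)
  have hU : Finset.powersetCard n (Finset.Icc 1 n) = {Finset.Icc 1 n} := by
    simpa using Finset.powersetCard_self (Finset.Icc 1 n)
  rw [hU, Finset.sum_singleton] at this
  have h0 : G 0 (Finset.Icc 1 n) = 1 := by simp [G, prefList, naplesRunAux]
  rw [h0, mul_one] at this
  exact this.symm

theorem naplesWeight_Icc_erase {k n i : ℕ} (hi : i ≤ n) :
    naplesWeight k (n + 1) ((Finset.Icc 1 (n + 1)).erase (i + 1)) (i + 1)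
      = min (i + 1 + k) (n + 1) := by
  have : (Finset.Icc 1 (n + 1)).filter (fun a =>
      naplesTry k (n + 1) ((Finset.Icc 1 (n + 1)).erase (i + 1)) a = some (i + 1))
        = Finset.Icc 1 (min (i + 1 + k) (n + 1)) := by
    ext a
    simp only [Finset.mem_filter, Finset.mem_Icc]
    constructor
    · rintro ⟨⟨h₁, h₂⟩, h₃⟩
      rw [naplesTry_eq_some_iff h₁ h₂] at h₃
      lia
    · rintro ⟨h₁, h₂⟩
      refine ⟨⟨h₁, by lia⟩, (naplesTry_eq_some_iff h₁ (by lia)).2 ⟨by simp, ?_⟩⟩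
      simp only [Finset.mem_erase, Finset.mem_Icc]
      obtain h | h := le_or_gt (i + 1) a
      · exact Or.inl ⟨by lia, h, by lia, fun x _ _ => by lia⟩
      · exact Or.inr ⟨h, by lia, fun x _ _ _ => by lia⟩
  rw [naplesWeight, this, Nat.card_Icc, Nat.add_sub_cancel]

theorem naplesWeight_union_left {k n i s : ℕ} {A B : Finset ℕ} (hi : i + 1 ≤ n)
    (hA : A ⊆ Finset.Icc 1 i) (hB : B ⊆ Finset.Icc (i + 2) n) (hs : s ∈ Finset.Icc 1 i) :
    naplesWeight k n (A ∪ B) s = naplesWeight k i A s := by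
  rw [naplesWeight, naplesWeight]
  congr 1
  have hA' : ∀ x ∈ A, 1 ≤ x ∧ x ≤ i := fun x hx => Finset.mem_Icc.1 (hA hx)
  have hB' : ∀ x ∈ B, i + 2 ≤ x ∧ x ≤ n := fun x hx => Finset.mem_Icc.1 (hB hx)
  have hfree : i + 1 ∉ A ∪ B := by
    rw [Finset.mem_union]
    rintro (h | h)
    · have := hA' _ h
      lia
    · have := hB' _ h
      lia
  have hmem : ∀ x ≤ i, (x ∈ A ∪ B ↔ x ∈ A) := by
    intro x hx
    rw [Finset.mem_union, or_iff_left]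
    intro h
    have := hB' _ h
    lia
  rw [Finset.mem_Icc] at hs
  ext a
  simp only [Finset.mem_filter, Finset.mem_Icc]
  constructor
  · rintro ⟨⟨h₁, h₂⟩, h₃⟩
    rw [naplesTry_eq_some_iff h₁ h₂] at h₃
    have hai : a ≤ i := by
      by_contra! hai
      obtain ⟨-, ⟨-, -, -, h⟩ | ⟨h, -⟩⟩ := h₃
      · exact hfree (h _ (by lia) hai)
      · lia
    refine ⟨⟨h₁, hai⟩, (naplesTry_eq_some_iff h₁ hai).2 ⟨by rw [← hmem s hs.2]; exact h₃.1, ?_⟩⟩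
    obtain ⟨-, ⟨h₄, h₅, h₆, h⟩ | ⟨h₄, h₅, h⟩⟩ := h₃
    · exact Or.inl ⟨h₄, h₅, h₆, fun x hx hxa => (hmem x (by lia)).1 (h x hx hxa)⟩
    · exact Or.inr ⟨h₄, hs.2, fun x hx hxk hxs => (hmem x (by lia)).1 (h x hx hxk hxs)⟩
  · rintro ⟨⟨h₁, h₂⟩, h₃⟩
    rw [naplesTry_eq_some_iff h₁ h₂] at h₃
    refine ⟨⟨h₁, by lia⟩, (naplesTry_eq_some_iff h₁ (by lia)).2
      ⟨by rw [hmem s hs.2]; exact h₃.1, ?_⟩⟩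
    obtain ⟨-, ⟨h₄, h₅, h₆, h⟩ | ⟨h₄, h₅, h⟩⟩ := h₃
    · exact Or.inl ⟨h₄, h₅, h₆, fun x hx hxa => (hmem x (by lia)).2 (h x hx hxa)⟩
    · exact Or.inr ⟨h₄, by lia, fun x hx hxk hxs => (hmem x (by lia)).2 (h x hx hxk hxs)⟩

/-- The `k`-Naples rule on a circular street with `m + 1` spots. -/
def circularTry (k m : ℕ) (occ : Finset (ZMod (m + 1))) (a : ZMod (m + 1)) :
    Option (ZMod (m + 1)) :=
  ((List.range (k + 1)).map (fun j : ℕ => a - (j : ZMod (m + 1))) ++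
    (List.range (m + 1)).map (fun j : ℕ => a + (j : ZMod (m + 1)))).find? (fun s => decide (s ∉ occ))

theorem circularTry_eq_some_iff {k m : ℕ} {occ : Finset (ZMod (m + 1))} {a s : ZMod (m + 1)} :
    circularTry k m occ a = some s ↔ s ∉ occ ∧
      ((∃ d ≤ k, s = a - d ∧ ∀ e < d, a - (e : ZMod (m + 1)) ∈ occ) ∨
        (∀ e ≤ k, a - (e : ZMod (m + 1)) ∈ occ) ∧
          ∃ d ≤ m, s = a + d ∧ ∀ e < d, a + (e : ZMod (m + 1)) ∈ occ) := by
  simp only [circularTry, List.find?_append, Option.or_eq_some_iff, List.find?_map,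
    Option.map_eq_some_iff, Option.map_eq_none_iff, List.find?_range_eq_some,
    List.find?_range_eq_none, List.mem_range, Function.comp_apply, decide_eq_true_eq,
    Bool.not_eq_true', decide_eq_false_iff_not, not_not, Nat.lt_succ_iff]
  constructor
  · rintro (⟨d, ⟨h₁, h₂, h₃⟩, rfl⟩ | ⟨h, d, ⟨h₁, h₂, h₃⟩, rfl⟩)
    · exact ⟨h₁, Or.inl ⟨d, h₂, rfl, h₃⟩⟩
    · exact ⟨h₁, Or.inr ⟨h, d, h₂, rfl, h₃⟩⟩
  · rintro ⟨h₁, ⟨d, h₂, rfl, h₃⟩ | ⟨h, d, h₂, rfl, h₃⟩⟩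
    · exact Or.inl ⟨d, ⟨h₁, h₂, h₃⟩, rfl⟩
    · exact Or.inr ⟨h, d, ⟨h₁, h₂, h₃⟩, rfl⟩

theorem circularTry_isSome {k m : ℕ} {occ : Finset (ZMod (m + 1))} (a : ZMod (m + 1))
    (h : occ.card ≤ m) : (circularTry k m occ a).isSome := by
  obtain ⟨s, hs⟩ : ∃ s, s ∉ occ := by
    by_contra! hall
    have := congrArg Finset.card (Finset.eq_univ_iff_forall.2 hall)
    rw [Finset.card_univ, ZMod.card] at this
    lia
  rw [circularTry, List.find?_isSome]
  refine ⟨s, List.mem_append_right _ (List.mem_map.2 ⟨(s - a).val, ?_, ?_⟩), by simpa using hs⟩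
  · exact List.mem_range.2 (ZMod.val_lt _)
  · rw [ZMod.natCast_zmod_val]
    ring

/-- The number of preferences that send a car to the spot `s` under the circular `k`-Naples rule. -/
def circularWeight (k m : ℕ) (occ : Finset (ZMod (m + 1))) (s : ZMod (m + 1)) : ℕ :=
  (Finset.univ.filter fun a => circularTry k m occ a = some s).card

theorem sum_circularWeight (k m : ℕ) {occ : Finset (ZMod (m + 1))} (h : occ.card ≤ m) :
    ∑ s ∈ Finset.univ \ occ, circularWeight k m occ s = m + 1 := by
  simp only [circularWeight, Finset.card_filter]
  rw [Finset.sum_comm]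
  calc
    _ = ∑ _a : ZMod (m + 1), 1 := by
      refine Finset.sum_congr rfl fun a _ => ?_
      obtain ⟨s, hs⟩ := Option.isSome_iff_exists.1 (circularTry_isSome (k := k) a h)
      have hmem := (circularTry_eq_some_iff.1 hs).1
      simp [hs, hmem]
    _ = m + 1 := by simp [ZMod.card]

theorem circularWeight_image_add (k m : ℕ) (occ : Finset (ZMod (m + 1))) (s x : ZMod (m + 1)) :
    circularWeight k m (occ.image (· + x)) (s + x) = circularWeight k m occ s := by
  have hmem : ∀ y, y + x ∈ occ.image (· + x) ↔ y ∈ occ := by simp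
  have hsub : ∀ a b : ZMod (m + 1), a + x - b = a - b + x := fun a b => by ring
  have hadd : ∀ a b : ZMod (m + 1), a + x + b = a + b + x := fun a b => by ring
  symm
  refine Finset.card_equiv (Equiv.addRight x) fun a => ?_
  simp only [Finset.mem_filter, Finset.mem_univ, true_and, Equiv.coe_addRight,
    circularTry_eq_some_iff, hsub, hadd, hmem, add_left_inj]

theorem parkingWays_circularWeight (k m : ℕ) :
    parkingWays (circularWeight k m) m (Finset.univ.erase 0) = (m + 1) ^ (m - 1) := by
  have hshift : ∀ x, parkingWays (circularWeight k m) m (Finset.univ.erase x)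
      = parkingWays (circularWeight k m) m (Finset.univ.erase 0) := by
    intro x
    have himage : Finset.univ.erase x = (Finset.univ.erase 0).image (· + x) := by
      ext y
      simp [add_neg_eq_zero]
    rw [himage]
    exact parkingWays_image m (add_left_injective x).injOn
      fun T _ s _ _ => circularWeight_image_add k m T s x
  have hsum := sum_parkingWays_mul (U := Finset.univ) (c := circularWeight k m)
    (G := fun t _ => (m + 1) ^ t) (b := m)
    (fun t T _ hT => by
      rw [← Finset.sum_mul, sum_circularWeight k m (by lia)]
      ring) m 0 rfl
  have hpow : ∑ S ∈ Finset.univ.powersetCard m, parkingWays (circularWeight k m) m S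
      = ∑ x : ZMod (m + 1), parkingWays (circularWeight k m) m (Finset.univ.erase x) := by
    symm
    refine Finset.sum_bij (fun x _ => Finset.univ.erase x) ?_ ?_ ?_ fun _ _ => rfl
    · intro x _
      simp [Finset.mem_powersetCard, ZMod.card]
    · intro x _ y _ hxy
      by_contra hne
      exact Finset.notMem_erase x Finset.univ
        (by rw [hxy]; exact Finset.mem_erase.2 ⟨hne, Finset.mem_univ _⟩)
    · intro S hS
      rw [Finset.mem_powersetCard] at hS
      obtain ⟨x, hx⟩ := Finset.card_eq_one.1
        (show Sᶜ.card = 1 by rw [Finset.card_compl, ZMod.card, hS.2]; lia)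
      refine ⟨x, Finset.mem_univ _, ?_⟩
      rw [← compl_compl S, hx]
      ext y
      simp
  simp only [pow_zero, mul_one] at hsum
  rw [hpow, Finset.sum_congr rfl fun x _ => hshift x, Finset.sum_const, Finset.card_univ,
    ZMod.card, smul_eq_mul] at hsum
  obtain _ | m := m
  · simpa using hsum
  · rw [pow_succ'] at hsum
    exact Nat.eq_of_mul_eq_mul_left (by lia) hsum

theorem natCast_sub_injOn (i m : ℕ) :
    Set.InjOn (fun x : ℕ => ((x - (i + 1) : ℕ) : ZMod (m + 1)))
      (Finset.Icc (i + 1) (i + 1 + m)) := by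
  intro x hx y hy hxy
  rw [Finset.coe_Icc, Set.mem_Icc] at hx hy
  have := congrArg ZMod.val hxy
  simp only at this
  rw [ZMod.val_natCast_of_lt (by lia), ZMod.val_natCast_of_lt (by lia)] at this
  lia

theorem naplesWeight_union_right {k m i s : ℕ} {A B : Finset ℕ}
    (hA : A ⊆ Finset.Icc 1 i) (hB : B ⊆ Finset.Icc (i + 2) (i + 1 + m))
    (hs : s ∈ Finset.Icc (i + 2) (i + 1 + m)) :
    naplesWeight k (i + 1 + m) (A ∪ B) s
      = circularWeight k m (B.image fun x : ℕ => ((x - (i + 1) : ℕ) : ZMod (m + 1)))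
          ((s - (i + 1) : ℕ) : ZMod (m + 1)) := by
  set φ : ℕ → ZMod (m + 1) := fun x => ((x - (i + 1) : ℕ) : ZMod (m + 1)) with hφ
  have hinj : ∀ x y, i + 1 ≤ x → x ≤ i + 1 + m → i + 1 ≤ y → y ≤ i + 1 + m → φ x = φ y → x = y :=
    fun x y h₁ h₂ h₃ h₄ h => natCast_sub_injOn i m (by simp; lia) (by simp; lia) h
  have hA' : ∀ x ∈ A, 1 ≤ x ∧ x ≤ i := fun x hx => Finset.mem_Icc.1 (hA hx)
  have hB' : ∀ x ∈ B, i + 2 ≤ x ∧ x ≤ i + 1 + m := fun x hx => Finset.mem_Icc.1 (hB hx)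
  rw [Finset.mem_Icc] at hs
  have hmem : ∀ x, i + 1 ≤ x → x ≤ i + 1 + m → (φ x ∈ B.image φ ↔ x ∈ A ∪ B) := by
    intro x h₁ h₂
    rw [Finset.mem_union, or_iff_right (fun h => by have := hA' _ h; lia), Finset.mem_image]
    constructor
    · rintro ⟨y, hy, hyx⟩
      have := hB' y hy
      rwa [← hinj y x (by lia) this.2 h₁ h₂ hyx]
    · exact fun h => ⟨x, h, rfl⟩
  have hfree : i + 1 ∉ A ∪ B := by
    rw [Finset.mem_union]
    rintro (h | h)
    · have := hA' _ h
      lia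
    · have := hB' _ h
      lia
  have hfree' : φ (i + 1) ∉ B.image φ := by rwa [hmem _ le_rfl (by lia)]
  have hwrap : φ (i + 1 + m + 1) = φ (i + 1) := by
    simp only [hφ]
    rw [show i + 1 + m + 1 - (i + 1) = m + 1 by lia, ZMod.natCast_self]
    simp
  have hsub : ∀ a e : ℕ, e + (i + 1) ≤ a → φ a - (e : ZMod (m + 1)) = φ (a - e) := by
    intro a e h
    simp only [hφ]
    rw [← Nat.cast_sub (by lia)]
    congr 1
    lia
  have hadd : ∀ a e : ℕ, i + 1 ≤ a → φ a + (e : ZMod (m + 1)) = φ (a + e) := by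
    intro a e h
    simp only [hφ]
    rw [← Nat.cast_add]
    congr 1
    lia
  have hkey : ∀ a, i + 2 ≤ a → a ≤ i + 1 + m →
      (circularTry k m (B.image φ) (φ a) = some (φ s) ↔
        naplesTry k (i + 1 + m) (A ∪ B) a = some s) := by
    intro a h₁ h₂
    rw [circularTry_eq_some_iff, naplesTry_eq_some_iff (by lia) h₂, hmem s (by lia) hs.2]
    refine and_congr_right fun hsocc => ⟨?_, ?_⟩
    · rintro (⟨d, hdk, hd, hocc⟩ | ⟨hback, d, hdm, hd, hocc⟩)
      · obtain hda | hda := le_or_gt (d + (i + 1)) a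
        · rw [hsub a d hda] at hd
          obtain rfl := hinj s (a - d) (by lia) hs.2 (by lia) (by lia) hd
          refine Or.inl ⟨by lia, by lia, by lia, fun x hx hxa => ?_⟩
          have := hocc (a - x) (by lia)
          rwa [hsub _ _ (by lia), show a - (a - x) = x by lia, hmem x (by lia) (by lia)] at this
        · have := hocc (a - (i + 1)) (by lia)
          rw [hsub _ _ (by lia), show a - (a - (i + 1)) = i + 1 by lia] at this
          exact absurd this hfree'
      · have hka : k + (i + 1) < a := by
          by_contra! hka
          have := hback (a - (i + 1)) (by lia)
          rw [hsub _ _ (by lia), show a - (a - (i + 1)) = i + 1 by lia] at this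
          exact absurd this hfree'
        rw [hadd a d (by lia)] at hd
        obtain hda | hda | hda := lt_trichotomy (a + d) (i + 1 + m + 1)
        · obtain rfl := hinj s (a + d) (by lia) hs.2 (by lia) (by lia) hd
          have hforward : ∀ x, a ≤ x → x < a + d → x ∈ A ∪ B := by
            intro x hx hxs
            have := hocc (x - a) (by lia)
            rwa [hadd _ _ (by lia), show a + (x - a) = x by lia, hmem x (by lia) (by lia)] at this
          have hbackward : ∀ x, a ≤ x + k → x ≤ a → x ∈ A ∪ B := by
            intro x hx hxa
            have := hback (a - x) (by lia)
            rwa [hsub _ _ (by lia), show a - (a - x) = x by lia, hmem x (by lia) (by lia)] at this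
          have hd0 : d ≠ 0 := by
            rintro rfl
            exact hsocc (hbackward _ (by lia) (by lia))
          refine Or.inr ⟨by lia, by lia, fun x _ hxk hxs => ?_⟩
          obtain hxa | hxa := le_total x a
          · exact hbackward x hxk hxa
          · exact hforward x hxa hxs
        · rw [hda, hwrap] at hd
          have := hinj s (i + 1) (by lia) hs.2 le_rfl (by lia) hd
          lia
        · have := hocc (i + 1 + m + 1 - a) (by lia)
          rw [hadd _ _ (by lia), show a + (i + 1 + m + 1 - a) = i + 1 + m + 1 by lia,
            hwrap] at this
          exact absurd this hfree'
    · rintro (⟨-, hsa, hak, hocc⟩ | ⟨has, -, hocc⟩)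
      · refine Or.inl ⟨a - s, by lia, ?_, fun e he => ?_⟩
        · rw [hsub _ _ (by lia), show a - (a - s) = s by lia]
        · rw [hsub _ _ (by lia), hmem _ (by lia) (by lia)]
          exact hocc _ (by lia) (by lia)
      · have hka : k + (i + 1) < a := by
          by_contra! hka
          exact hfree (hocc _ (by lia) (by lia) (by lia))
        refine Or.inr ⟨fun e he => ?_, s - a, by lia, ?_, fun e he => ?_⟩
        · rw [hsub _ _ (by lia), hmem _ (by lia) (by lia)]
          exact hocc _ (by lia) (by lia) (by lia)
        · rw [hadd _ _ (by lia), show a + (s - a) = s by lia]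
        · rw [hadd _ _ (by lia), hmem _ (by lia) (by lia)]
          exact hocc _ (by lia) (by lia) (by lia)
  have hright : ∀ a, 1 ≤ a → a ≤ i + 1 + m →
      naplesTry k (i + 1 + m) (A ∪ B) a = some s → i + 2 ≤ a := by
    intro a h₁ h₂ h
    rw [naplesTry_eq_some_iff h₁ h₂] at h
    by_contra! hai
    obtain ⟨-, ⟨-, h, -⟩ | ⟨-, -, h⟩⟩ := h
    · lia
    · exact hfree (h _ (by lia) (by lia) (by lia))
  rw [naplesWeight, circularWeight]
  refine Finset.card_nbij φ ?_ ?_ ?_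
  · intro a ha
    simp only [Finset.mem_coe, Finset.mem_filter, Finset.mem_Icc, Finset.mem_univ, true_and] at ha ⊢
    exact (hkey a (hright a ha.1.1 ha.1.2 ha.2) ha.1.2).2 ha.2
  · intro a ha b hb hab
    simp only [Finset.mem_coe, Finset.mem_filter, Finset.mem_Icc] at ha hb
    have := hright a ha.1.1 ha.1.2 ha.2
    have := hright b hb.1.1 hb.1.2 hb.2
    exact hinj a b (by lia) ha.1.2 (by lia) hb.1.2 hab
  · intro b hb
    simp only [Finset.mem_coe, Finset.mem_filter, Finset.mem_univ, true_and] at hb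
    have hlt := ZMod.val_lt b
    have hφb : φ (i + 1 + b.val) = b := by
      simp only [hφ]
      rw [Nat.add_sub_cancel_left, ZMod.natCast_zmod_val]
    have hb0 : b.val ≠ 0 := by
      intro h0
      rw [h0, add_zero] at hφb
      rw [← hφb, circularTry_eq_some_iff] at hb
      obtain ⟨-, ⟨d, -, hd, h⟩ | ⟨h, -⟩⟩ := hb
      · obtain _ | d := d
        · rw [Nat.cast_zero, sub_zero] at hd
          have := hinj s (i + 1) (by lia) hs.2 le_rfl (by lia) hd
          lia
        · exact hfree' (by simpa using h 0 (by lia))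
      · exact hfree' (by simpa using h 0 (by lia))
    refine ⟨i + 1 + b.val, ?_, hφb⟩
    simp only [Finset.mem_coe, Finset.mem_filter, Finset.mem_Icc]
    refine ⟨by lia, (hkey _ (by lia) (by lia)).1 ?_⟩
    rwa [hφb]

theorem parkingWays_naplesWeight_erase (k i m : ℕ) :
    parkingWays (naplesWeight k (i + 1 + m)) (i + m) ((Finset.Icc 1 (i + 1 + m)).erase (i + 1))
      = (i + m).choose i * (naplesPFs k i i).card * (m + 1) ^ (m - 1) := by
  have hsplit : (Finset.Icc 1 (i + 1 + m)).erase (i + 1)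
      = Finset.Icc 1 i ∪ Finset.Icc (i + 2) (i + 1 + m) := by
    ext x
    simp only [Finset.mem_erase, Finset.mem_union, Finset.mem_Icc]
    lia
  have hinj : Set.InjOn (fun x : ℕ => ((x - (i + 1) : ℕ) : ZMod (m + 1)))
      (Finset.Icc (i + 2) (i + 1 + m)) :=
    (natCast_sub_injOn i m).mono (by
      exact_mod_cast Finset.Icc_subset_Icc (by lia) le_rfl)
  have himage : (Finset.Icc (i + 2) (i + 1 + m)).image
      (fun x : ℕ => ((x - (i + 1) : ℕ) : ZMod (m + 1))) = Finset.univ.erase 0 := by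
    refine Finset.eq_of_subset_of_card_le ?_ ?_
    · intro y hy
      rw [Finset.mem_image] at hy
      obtain ⟨x, hx, rfl⟩ := hy
      rw [Finset.mem_Icc] at hx
      refine Finset.mem_erase.2 ⟨fun h => ?_, Finset.mem_univ _⟩
      have := congrArg ZMod.val h
      rw [ZMod.val_natCast_of_lt (by lia), ZMod.val_zero] at this
      lia
    · rw [Finset.card_image_of_injOn hinj, Finset.card_erase_of_mem (Finset.mem_univ _),
        Finset.card_univ, ZMod.card, Nat.card_Icc]
      lia
  rw [hsplit, card_naplesPFs_eq, ← parkingWays_circularWeight k m, ← himage,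
    parkingWays_image (c := fun T s => circularWeight k m
      (T.image fun x : ℕ => ((x - (i + 1) : ℕ) : ZMod (m + 1)))
        ((s - (i + 1) : ℕ) : ZMod (m + 1))) m hinj fun _ _ _ _ _ => rfl]
  refine parkingWays_union i m (by simp) (by rw [Nat.card_Icc]; lia) ?_ ?_ ?_
  · rw [Finset.disjoint_left]
    intro x hx hx'
    rw [Finset.mem_Icc] at hx hx'
    lia
  · exact fun A' hA' B' hB' s hs _ => naplesWeight_union_left (by lia) hA' hB' hs
  · exact fun A' hA' B' hB' s hs _ => naplesWeight_union_right hA' hB' hs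

theorem stmt18 (k n : ℕ) (h : k ≤ n - 1) :
    (naplesPFs k (n + 1) (n + 1)).card
      = ∑ i ∈ Finset.range (n + 1),
          (n.choose i) * (min (i + 1 + k) (n + 1)) * (naplesPFs k i i).card *
            (n - i + 1) ^ (n - i - 1) := by
  rw [card_naplesPFs_eq, parkingWays]
  symm
  refine Finset.sum_nbij (· + 1) ?_ ?_ ?_ ?_
  · intro i hi
    rw [Finset.mem_range] at hi
    rw [Finset.mem_Icc]
    lia
  · exact (add_left_injective 1).injOn
  · intro s hs
    rw [Finset.coe_Icc, Set.mem_Icc] at hs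
    exact ⟨s - 1, by simp; lia, by simp; lia⟩
  · intro i hi
    rw [Finset.mem_range] at hi
    obtain ⟨m, rfl⟩ := Nat.exists_eq_add_of_le (Nat.lt_succ_iff.1 hi)
    rw [naplesWeight_Icc_erase (by lia), show i + m + 1 = i + 1 + m by lia,
      parkingWays_naplesWeight_erase, Nat.add_sub_cancel_left]
    ring
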